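/- arXiv:2005.02974 — 2 statements merged into one kernel-verified Lean document; each statement's English description precedes it below -/
import Mathlib

section
/- Let A, X, E be n×n complex matrices with E invertible and Hermitian. If X·A·X = X and the column space of E·A equals the column space of X^*, then A·X·A = A. -/
open Matrix

/-- An outer inverse `X` of `A` with `rank A ≤ rank X` is also an inner inverse. -/
theorem Matrix.mul_mul_eq_self_of_rank_le {K m n : Type*} [Field K] [Fintype m] [Fintype n]
    {A : Matrix m n K} {X : Matrix n m K}
    (hX : X * A * X = X) (hrank : A.rank ≤ X.rank) : A * X * A = A := by
  have hle : LinearMap.range (A * X).mulVecLin ≤ LinearMap.range A.mulVecLin := by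
    rw [mulVecLin_mul]
    exact LinearMap.range_comp_le_range _ _
  have hXA : X.rank ≤ (A * X).rank := by
    conv_lhs => rw [← hX, Matrix.mul_assoc]
    exact rank_mul_le_right _ _
  have hrange := Submodule.eq_of_le_of_finrank_le hle (hrank.trans hXA)
  classical
  refine Matrix.ext_of_mulVec_single fun i => ?_
  obtain ⟨w, hw⟩ : A *ᵥ Pi.single i 1 ∈ LinearMap.range (A * X).mulVecLin :=
    hrange ▸ ⟨Pi.single i 1, rfl⟩
  rw [mulVecLin_apply] at hw
  rw [← mulVec_mulVec, ← hw, mulVec_mulVec, Matrix.mul_assoc, ← Matrix.mul_assoc X, hX]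

/-- If X·A·X = X and the column space of E·A equals the column space of Xᴴ,
then A·X·A = A. -/
theorem stmt_1 {n : ℕ} (A X E : Matrix (Fin n) (Fin n) ℂ)
    (hE : IsUnit E) (hEherm : Eᴴ = E)
    (h2 : X * A * X = X)
    (hrange : LinearMap.range (E * A).mulVecLin = LinearMap.range Xᴴ.mulVecLin) :
    A * X * A = A := by
  have hX : Xᴴ.rank = X.rank := open scoped ComplexOrder in rank_conjTranspose X
  refine mul_mul_eq_self_of_rank_le h2 (le_of_eq ?_)
  rw [← rank_mul_eq_right_of_isUnit_det E A ((isUnit_iff_isUnit_det E).mp hE), ← hX,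
    rank, rank, hrange]
end

section
/- Let A, E be n×n complex matrices with E invertible and Hermitian. Then there exists an n×n complex matrix X with A = X·(A^*)^2·E·A if and only if there exist n×n complex matrices Y and Z with A = Y·A^*·E·A and A = A^2·Z. -/
open Matrix

/-- A square matrix whose rank does not exceed that of its square factors through its square. -/
theorem exists_eq_sq_mul_of_rank_le {m K : Type*} [Fintype m] [DecidableEq m] [Field K]
    {A : Matrix m m K} (h : A.rank ≤ (A ^ 2).rank) : ∃ Z : Matrix m m K, A = A ^ 2 * Z := by
  have hle : LinearMap.range (A ^ 2).mulVecLin ≤ LinearMap.range A.mulVecLin := by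
    rw [pow_two, mulVecLin_mul]
    exact LinearMap.range_comp_le_range _ _
  have heq := Submodule.eq_of_le_of_finrank_le hle h
  have hcol (j : m) : ∃ z : m → K, A ^ 2 *ᵥ z = A.col j := by
    have hj : A.col j ∈ LinearMap.range A.mulVecLin := ⟨Pi.single j 1, by simp⟩
    rwa [← heq] at hj
  choose z hz using hcol
  refine ⟨(Matrix.of z)ᵀ, ?_⟩
  ext i j
  exact (congrFun (hz j) i).symm

/-- A = X·(Aᴴ)²·E·A for some X iff A = Y·Aᴴ·E·A and A = A²·Z for some Y, Z. -/
theorem stmt_8 {n : ℕ} (A E : Matrix (Fin n) (Fin n) ℂ)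
    (hE : IsUnit E) (hEherm : Eᴴ = E) :
    (∃ X : Matrix (Fin n) (Fin n) ℂ, A = X * Aᴴ ^ 2 * E * A) ↔
    (∃ Y Z : Matrix (Fin n) (Fin n) ℂ, A = Y * Aᴴ * E * A ∧ A = A ^ 2 * Z) := by
  constructor
  · rintro ⟨X, hX⟩
    have hrank : A.rank ≤ (A ^ 2).rank := calc
      A.rank = (X * (Aᴴ ^ 2 * (E * A))).rank := by
        rw [← Matrix.mul_assoc, ← Matrix.mul_assoc, ← hX]
      _ ≤ (Aᴴ ^ 2 * (E * A)).rank := rank_mul_le_right _ _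
      _ ≤ (Aᴴ ^ 2).rank := rank_mul_le_left _ _
      _ = (A ^ 2).rank := by
        open scoped ComplexOrder in rw [← conjTranspose_pow, rank_conjTranspose]
    obtain ⟨Z, hZ⟩ := exists_eq_sq_mul_of_rank_le hrank
    exact ⟨X * Aᴴ, Z, by rwa [Matrix.mul_assoc X, ← pow_two], hZ⟩
  · rintro ⟨Y, Z, hY, hZ⟩
    have hA : Zᴴ * Aᴴ ^ 2 = Aᴴ := by
      rw [← conjTranspose_pow, ← conjTranspose_mul, ← hZ]
    exact ⟨Y * Zᴴ, by rwa [Matrix.mul_assoc Y, hA]⟩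
end
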